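/- Let f be a smooth function on an open neighborhood of 0 in ℝ³. Then the following are equivalent: (a) ∂^β f(0) = 0 for every multiindex β; (b) for every N > 0 there exists δ > 0 such that sup_{0 < r ≤ δ} r^{−N} ‖f‖_{L²(B(0,r))} < ∞, where ‖f‖_{L²(B(0,r))} = (∫_{|x| ≤ r} |f|² dx)^{1/2}. -/

import Mathlib

open MeasureTheory Metric Finset

noncomputable section

/-- `ℝ³` with the Euclidean norm. -/
abbrev E3 := EuclideanSpace ℝ (Fin 3)
/-- `ℝ⁷` with the Euclidean norm. -/
abbrev E7 := EuclideanSpace ℝ (Fin 7)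

/-- The partial derivative `∂_i f`. -/
def pd (i : Fin 3) (f : E3 → ℝ) : E3 → ℝ :=
  fun x => fderiv ℝ f x (EuclideanSpace.single i 1)

/-- The multiindex partial derivative `∂^β f`. -/
def mpd (β : Fin 3 → ℕ) (f : E3 → ℝ) : E3 → ℝ :=
  (pd 0)^[β 0] ((pd 1)^[β 1] ((pd 2)^[β 2] f))

/-- The length `|β|` of a multiindex. -/
def mdeg (β : Fin 3 → ℕ) : ℕ := β 0 + β 1 + β 2

/-- `f` belongs to the Gevrey class `G^s(Ω)`. -/
def GevreyOn (s : ℝ) (Ω : Set E3) (f : E3 → ℝ) : Prop :=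
  ContDiffOn ℝ (⊤ : ℕ∞) f Ω ∧ ∃ c > 0, ∃ A > 0, ∀ β : Fin 3 → ℕ, ∀ x ∈ Ω,
    |mpd β f x| ≤ c * A ^ mdeg β * (Nat.factorial (mdeg β) : ℝ) ^ s

/-- The second-order operator `Σ_{j,k} a_jk(x) ∂²_{jk}` applied to a scalar function. -/
def op2 (a : Fin 3 → Fin 3 → E3 → ℝ) (f : E3 → ℝ) : E3 → ℝ :=
  fun x => ∑ j, ∑ k, a j k x * pd j (pd k f) x

/-- Uniform (strong) ellipticity of `Σ_{j,k} a_jk(x) ∂²_{jk}` on `Ω`. -/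
def UnifElliptic (a : Fin 3 → Fin 3 → E3 → ℝ) (Ω : Set E3) : Prop :=
  ∃ c0 > 0, ∀ x ∈ Ω, ∀ ξ : Fin 3 → ℝ,
    c0 * (∑ i, ξ i ^ 2) ≤ ∑ j, ∑ k, a j k x * ξ j * ξ k

/-- The coefficient matrix of the operator at a point. -/
def coefMatrix (a : Fin 3 → Fin 3 → E3 → ℝ) (x : E3) : Matrix (Fin 3) (Fin 3) ℝ :=
  Matrix.of fun j k => a j k x

/-- `α > (λ₃ - λ₁)/λ₁` where `λ₁ ≤ λ₂ ≤ λ₃` are the eigenvalues of the coefficient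
matrix at `0`: equivalently (the eigenvalues being positive), for any pair of
eigenvalues the corresponding ratio is `< α`. -/
def EigCond (a : Fin 3 → Fin 3 → E3 → ℝ) (α : ℝ) : Prop :=
  ∀ h : (coefMatrix a 0).IsHermitian, ∀ i j : Fin 3,
    (h.eigenvalues i - h.eigenvalues j) / h.eigenvalues j < α

/-- The coefficients `a¹_jk = μ δ_jk + t_jk` of `P₁`. -/
def a1coef (t : Fin 3 → Fin 3 → E3 → ℝ) (mu : E3 → ℝ) : Fin 3 → Fin 3 → E3 → ℝ :=
  fun j k x => mu x * (if j = k then 1 else 0) + t j k x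

/-- The coefficients `a²_jk = (λ + 2μ) δ_jk + t_jk` of `P₂`. -/
def a2coef (t : Fin 3 → Fin 3 → E3 → ℝ) (lam mu : E3 → ℝ) : Fin 3 → Fin 3 → E3 → ℝ :=
  fun j k x => (lam x + 2 * mu x) * (if j = k then 1 else 0) + t j k x

/-- The divergence `∇·u`. -/
def divg (u : E3 → Fin 3 → ℝ) (x : E3) : ℝ := ∑ i, pd i (fun y => u y i) x

/-- The curl `∇×u`. -/
def curl (u : E3 → Fin 3 → ℝ) (x : E3) : Fin 3 → ℝ :=
  ![pd 1 (fun y => u y 2) x - pd 2 (fun y => u y 1) x,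
    pd 2 (fun y => u y 0) x - pd 0 (fun y => u y 2) x,
    pd 0 (fun y => u y 1) x - pd 1 (fun y => u y 0) x]

/-- The infinitesimal strain `E = (∇u + (∇u)ᵗ)/2`. -/
def strain (u : E3 → Fin 3 → ℝ) (x : E3) (i j : Fin 3) : ℝ :=
  (pd j (fun y => u y i) x + pd i (fun y => u y j) x) / 2

/-- The stress tensor `σ = T + (∇u)T + λ(tr E)I + 2μE`. -/
def stress (t : Fin 3 → Fin 3 → E3 → ℝ) (lam mu : E3 → ℝ) (u : E3 → Fin 3 → ℝ)
    (x : E3) (i j : Fin 3) : ℝ :=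
  t i j x + (∑ k, pd k (fun y => u y i) x * t k j x)
    + lam x * divg u x * (if i = j then 1 else 0)
    + 2 * mu x * strain u x i j

/-- The residual stress system `∇·σ + κ²ρu = 0` on `Ω`. -/
def ResSystem (t : Fin 3 → Fin 3 → E3 → ℝ) (lam mu rho : E3 → ℝ) (κ : ℝ)
    (u : E3 → Fin 3 → ℝ) (Ω : Set E3) : Prop :=
  ∀ x ∈ Ω, ∀ i : Fin 3,
    (∑ j, pd j (fun y => stress t lam mu u y i j) x) + κ ^ 2 * rho x * u x i = 0

/-- The vector `U = (u, ∇·u, ∇×u) : Ω → ℝ⁷`. -/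
def Ufull (u : E3 → Fin 3 → ℝ) : E3 → Fin 7 → ℝ :=
  fun x => ![u x 0, u x 1, u x 2, divg u x, curl u x 0, curl u x 1, curl u x 2]

/-- The lower-order term `Σ_{|β|≤3} a_β ∂^β U`, component `i`. -/
def lowOrd (aβ : (Fin 3 → ℕ) → E3 → Fin 7 → Fin 7 → ℝ) (U : E3 → Fin 7 → ℝ)
    (x : E3) (i : Fin 7) : ℝ :=
  ∑ β ∈ Finset.univ.filter (fun β : Fin 3 → Fin 4 => mdeg (fun k => (β k : ℕ)) ≤ 3),
    ∑ j, aβ (fun k => (β k : ℕ)) x i j * mpd (fun k => (β k : ℕ)) (fun y => U y j) x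


theorem ContDiffOn.pd {Ω : Set E3} (hΩ : IsOpen Ω) {f : E3 → ℝ}
    (hf : ContDiffOn ℝ (⊤ : ℕ∞) f Ω) (i : Fin 3) : ContDiffOn ℝ (⊤ : ℕ∞) (pd i f) Ω :=
  (hf.fderiv_of_isOpen hΩ (by norm_cast)).clm_apply contDiffOn_const

theorem ContDiffOn.iterate_pd {Ω : Set E3} (hΩ : IsOpen Ω) {f : E3 → ℝ}
    (hf : ContDiffOn ℝ (⊤ : ℕ∞) f Ω) (i : Fin 3) (n : ℕ) :
    ContDiffOn ℝ (⊤ : ℕ∞) ((_root_.pd i)^[n] f) Ω := by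
  induction n with
  | zero => exact hf
  | succ n ih => rw [Function.iterate_succ_apply']; exact ih.pd hΩ i

theorem Set.EqOn.pd {Ω : Set E3} (hΩ : IsOpen Ω) {f g : E3 → ℝ} (h : Set.EqOn f g Ω)
    (i : Fin 3) : Set.EqOn (pd i f) (pd i g) Ω := fun x hx => by
  have : f =ᶠ[nhds x] g := h.eventuallyEq_of_mem (hΩ.mem_nhds hx)
  simp only [_root_.pd, this.fderiv_eq]

theorem Set.EqOn.iterate_pd {Ω : Set E3} (hΩ : IsOpen Ω) {f g : E3 → ℝ} (h : Set.EqOn f g Ω)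
    (i : Fin 3) (n : ℕ) : Set.EqOn ((_root_.pd i)^[n] f) ((_root_.pd i)^[n] g) Ω := by
  induction n with
  | zero => exact h
  | succ n ih => simp only [Function.iterate_succ_apply']; exact ih.pd hΩ i

theorem pd_comm {Ω : Set E3} (hΩ : IsOpen Ω) {f : E3 → ℝ}
    (hf : ContDiffOn ℝ (⊤ : ℕ∞) f Ω) (i j : Fin 3) :
    Set.EqOn (pd i (pd j f)) (pd j (pd i f)) Ω := by
  intro x hx
  have hd : DifferentiableAt ℝ (fderiv ℝ f) x :=
    ((hf.fderiv_of_isOpen hΩ (m := (⊤ : ℕ∞)) (by norm_cast)).contDiffAt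
      (hΩ.mem_nhds hx)).differentiableAt (by simp)
  have hs : IsSymmSndFDerivAt ℝ f x :=
    (hf.contDiffAt (hΩ.mem_nhds hx)).isSymmSndFDerivAt (by
      rw [minSmoothness_of_isRCLikeNormedField]
      exact WithTop.coe_le_coe.2 (le_top : (2 : ℕ∞) ≤ ⊤))
  have key : ∀ k l : Fin 3, pd k (pd l f) x =
      fderiv ℝ (fderiv ℝ f) x (EuclideanSpace.single k 1) (EuclideanSpace.single l 1) := by
    intro k l
    unfold pd
    rw [fderiv_clm_apply hd (differentiableAt_const _)]
    simp
  rw [key, key]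
  exact hs _ _

theorem iterate_pd_pd_comm {Ω : Set E3} (hΩ : IsOpen Ω) {f : E3 → ℝ}
    (hf : ContDiffOn ℝ (⊤ : ℕ∞) f Ω) (i j : Fin 3) (n : ℕ) :
    Set.EqOn ((pd i)^[n] (pd j f)) (pd j ((pd i)^[n] f)) Ω := by
  induction n with
  | zero => exact fun _ _ => rfl
  | succ n ih =>
    simp only [Function.iterate_succ_apply']
    exact (ih.pd hΩ i).trans (pd_comm hΩ (hf.iterate_pd hΩ i n) i j)

theorem mpd_pd {Ω : Set E3} (hΩ : IsOpen Ω) {f : E3 → ℝ}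
    (hf : ContDiffOn ℝ (⊤ : ℕ∞) f Ω) (β : Fin 3 → ℕ) (j : Fin 3) :
    Set.EqOn (mpd β (pd j f)) (mpd (Function.update β j (β j + 1)) f) Ω := by
  have h2 := hf.iterate_pd hΩ 2 (β 2)
  fin_cases j
  · simp only [mpd, Fin.zero_eta, Function.update_self, Function.iterate_succ_apply]
    refine Set.EqOn.iterate_pd hΩ ?_ _ _
    exact ((iterate_pd_pd_comm hΩ hf 2 0 _).iterate_pd hΩ _ _).trans
      (iterate_pd_pd_comm hΩ h2 1 0 _)
  · simp only [mpd, Fin.mk_one, Function.update_self, Function.iterate_succ_apply]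
    refine Set.EqOn.iterate_pd hΩ (Set.EqOn.iterate_pd hΩ ?_ _ _) _ _
    exact iterate_pd_pd_comm hΩ hf 2 1 _
  · exact fun _ _ => rfl

theorem norm_fderiv_le_sum_pd (f : E3 → ℝ) (x : E3) : ‖fderiv ℝ f x‖ ≤ ∑ i, |pd i f x| := by
  refine ContinuousLinearMap.opNorm_le_bound _ (Finset.sum_nonneg fun _ _ => abs_nonneg _) ?_
  intro v
  have hv : v = ∑ i, v i • EuclideanSpace.single i (1 : ℝ) := by
    simpa using ((EuclideanSpace.basisFun (Fin 3) ℝ).sum_repr v).symm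
  conv_lhs => rw [hv, map_sum]
  refine (norm_sum_le _ _).trans ?_
  rw [Finset.sum_mul]
  refine Finset.sum_le_sum fun i _ => ?_
  rw [map_smul, norm_smul, mul_comm]
  exact mul_le_mul_of_nonneg_left (PiLp.norm_apply_le v i) (abs_nonneg _)

/-- `f` vanishes to infinite order at `0`, in the uniform sense. -/
def IsFlat (f : E3 → ℝ) : Prop :=
  ∀ n : ℕ, ∃ C ≥ (0 : ℝ), ∃ δ > (0 : ℝ), ∀ r : ℝ, 0 < r → r ≤ δ → ∀ x, ‖x‖ ≤ r → |f x| ≤ C * r ^ n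

theorem IsFlat.apply_zero {f : E3 → ℝ} (h : IsFlat f) : f 0 = 0 := by
  obtain ⟨C, hC, δ, hδ, h⟩ := h 1
  by_contra hne
  have hpos : 0 < |f 0| := abs_pos.2 hne
  have hr : 0 < min δ (|f 0| / (2 * (C + 1))) := lt_min hδ (by positivity)
  have h1 := h _ hr (min_le_left _ _) 0 (by simpa using hr.le)
  have h2 : C * min δ (|f 0| / (2 * (C + 1))) ^ 1 ≤ (C + 1) * (|f 0| / (2 * (C + 1))) := by
    rw [pow_one]
    exact mul_le_mul (by linarith) (min_le_right _ _) hr.le (by linarith)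
  have h3 : (C + 1) * (|f 0| / (2 * (C + 1))) = |f 0| / 2 := by field_simp
  linarith

theorem exists_pow_bound_of_mpd_eq_zero {Ω : Set E3} (hΩ : IsOpen Ω) (h0 : (0 : E3) ∈ Ω) (n : ℕ) :
    ∀ f : E3 → ℝ, ContDiffOn ℝ (⊤ : ℕ∞) f Ω → (∀ β, mpd β f 0 = 0) →
      ∃ C ≥ (0 : ℝ), ∃ δ > (0 : ℝ), ∀ r : ℝ, 0 < r → r ≤ δ → ∀ x, ‖x‖ ≤ r → |f x| ≤ C * r ^ n := by
  obtain ⟨ρ, hρ, hρΩ⟩ := Metric.isOpen_iff.1 hΩ 0 h0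
  induction n with
  | zero =>
    intro f hf _
    have hc : Filter.Tendsto (fun x => |f x|) (nhds 0) (nhds |f 0|) :=
      (hf.continuousOn.continuousAt (hΩ.mem_nhds h0)).abs
    obtain ⟨δ, hδ, h⟩ := Metric.eventually_nhds_iff.1 (hc.eventually_le_const (lt_add_one |f 0|))
    refine ⟨|f 0| + 1, by positivity, δ / 2, by positivity, fun r _ hr x hx => ?_⟩
    simpa using h (y := x) (by rw [dist_zero_right]; linarith)
  | succ n ih =>
    intro f hf hβ
    have hpd : ∀ i, ∃ C ≥ (0 : ℝ), ∃ δ > (0 : ℝ), ∀ r : ℝ, 0 < r → r ≤ δ → ∀ x, ‖x‖ ≤ r →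
        |pd i f x| ≤ C * r ^ n := fun i =>
      ih (pd i f) (hf.pd hΩ i) fun β => by rw [mpd_pd hΩ hf β i h0]; exact hβ _
    choose C hC δ hδ h using hpd
    refine ⟨∑ i, C i, Finset.sum_nonneg fun i _ => hC i,
      min (ρ / 2) (min (δ 0) (min (δ 1) (δ 2))),
      lt_min (by positivity) (lt_min (hδ 0) (lt_min (hδ 1) (hδ 2))), fun r hr hrδ x hx => ?_⟩
    simp only [le_min_iff] at hrδ
    obtain ⟨hrρ, hr0, hr1, hr2⟩ := hrδ
    have hrδ : ∀ i, r ≤ δ i := by intro i; fin_cases i <;> assumption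
    have hmem : ∀ y ∈ Metric.closedBall (0 : E3) r, y ∈ Ω := fun y hy =>
      hρΩ (Metric.closedBall_subset_ball (by linarith) hy)
    have hmv := (convex_closedBall (0 : E3) r).norm_image_sub_le_of_norm_fderiv_le (𝕜 := ℝ) (f := f)
      (C := (∑ i, C i) * r ^ n) (x := 0) (y := x)
      (fun y hy => (hf.contDiffAt (hΩ.mem_nhds (hmem y hy))).differentiableAt (by simp))
      (fun y hy => (norm_fderiv_le_sum_pd f y).trans (by
        rw [Finset.sum_mul]
        exact Finset.sum_le_sum fun i _ => h i r hr (hrδ i) y (by simpa using hy)))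
      (by simpa using hr.le) (by simpa using hx)
    have hf0 : f 0 = 0 := hβ 0
    rw [hf0, sub_zero, sub_zero, Real.norm_eq_abs] at hmv
    refine hmv.trans ?_
    rw [pow_succ, ← mul_assoc]
    have := Finset.sum_nonneg fun i (_ : i ∈ Finset.univ) => hC i
    gcongr

theorem isFlat_of_mpd_eq_zero {Ω : Set E3} (hΩ : IsOpen Ω) (h0 : (0 : E3) ∈ Ω) {f : E3 → ℝ}
    (hf : ContDiffOn ℝ (⊤ : ℕ∞) f Ω) (h : ∀ β, mpd β f 0 = 0) : IsFlat f :=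
  fun n => exists_pow_bound_of_mpd_eq_zero hΩ h0 n f hf h

/-- Interpolation: a derivative is controlled by the function and a bound on second derivatives. -/
theorem IsFlat.pd {Ω : Set E3} (hΩ : IsOpen Ω) (h0 : (0 : E3) ∈ Ω) {f : E3 → ℝ}
    (hf : ContDiffOn ℝ (⊤ : ℕ∞) f Ω) (h : IsFlat f) (i : Fin 3) : IsFlat (pd i f) := by
  intro n
  obtain ⟨ρ, hρ, hρΩ⟩ := Metric.isOpen_iff.1 hΩ 0 h0
  have hcd : ContDiffAt ℝ 1 (fderiv ℝ f) 0 :=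
    (hf.fderiv_of_isOpen hΩ (m := 1) (by norm_cast)).contDiffAt (hΩ.mem_nhds h0)
  obtain ⟨K, t, ht, hK⟩ := hcd.exists_lipschitzOnWith
  obtain ⟨τ, hτ, hτt⟩ := Metric.mem_nhds_iff.1 ht
  obtain ⟨C, hC, δ, hδ, h⟩ := h (2 * (n + 1))
  refine ⟨C * 2 ^ (2 * (n + 1)) * 2 + K, by positivity,
    min 1 (min (δ / 2) (min (ρ / 3) (τ / 3))), by positivity, fun r hr hrδ x hx => ?_⟩
  simp only [le_min_iff] at hrδ
  obtain ⟨hr1, hrδ, hrρ, hrτ⟩ := hrδ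
  set s := r ^ (n + 1) with hs
  have hs0 : 0 < s := by positivity
  have hsn : s ≤ r ^ n := pow_le_pow_of_le_one hr.le hr1 (Nat.le_succ n)
  have hsr : s ≤ r := by
    simpa using pow_le_pow_of_le_one hr.le hr1 (Nat.succ_le_succ (Nat.zero_le n))
  have hball : ∀ y ∈ Metric.closedBall x s, ‖y‖ ≤ 2 * r := fun y hy => by
    have h1 : ‖y - x‖ ≤ s := by simpa [dist_eq_norm] using hy
    have h2 := norm_add_le (y - x) x
    rw [sub_add_cancel] at h2
    linarith
  set e : E3 := EuclideanSpace.single i 1 with he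
  have hne : ‖e‖ = 1 := by simp [he]
  have hxe : x + s • e ∈ Metric.closedBall x s := by
    simp [dist_eq_norm, norm_smul, hne, abs_of_pos hs0]
  have hmemt : ∀ y ∈ Metric.closedBall x s, y ∈ t := fun y hy =>
    hτt (by rw [mem_ball_zero_iff]; linarith [hball y hy])
  have hx0 : x ∈ Metric.closedBall x s := Metric.mem_closedBall_self hs0.le
  have hmv := (convex_closedBall x s).norm_image_sub_le_of_norm_fderiv_le' (𝕜 := ℝ) (f := f)
    (C := K * s) (x := x) (y := x + s • e) (φ := fderiv ℝ f x)
    (fun y hy => (hf.contDiffAt (hΩ.mem_nhds (hρΩ (by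
      rw [mem_ball_zero_iff]; linarith [hball y hy])))).differentiableAt (by simp))
    (fun y hy => by
      rw [← dist_eq_norm]
      exact (hK.dist_le_mul y (hmemt y hy) x (hmemt x hx0)).trans
        (mul_le_mul_of_nonneg_left hy K.2))
    hx0 hxe
  rw [add_sub_cancel_left, map_smul, norm_smul, hne, mul_one, Real.norm_eq_abs, Real.norm_eq_abs,
    abs_of_pos hs0, smul_eq_mul] at hmv
  have hpow : C * (2 * r) ^ (2 * (n + 1)) = C * 2 ^ (2 * (n + 1)) * (s * s) := by
    rw [hs, mul_pow, ← pow_add, ← two_mul, mul_assoc]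
  have h1 := h (2 * r) (by linarith) (by linarith) _ (hball _ hxe)
  have h2 := h (2 * r) (by linarith) (by linarith) _ (hball _ hx0)
  rw [hpow] at h1 h2
  have h3 : s * |_root_.pd i f x| ≤ s * ((C * 2 ^ (2 * (n + 1)) * 2 + K) * s) := by
    have h4 : s * |_root_.pd i f x| = |s * fderiv ℝ f x e| := by
      rw [abs_mul, abs_of_pos hs0]; rfl
    rw [h4]
    rw [abs_le] at *
    constructor <;> linarith
  refine (le_of_mul_le_mul_left h3 hs0).trans ?_
  gcongr

theorem IsFlat.iterate_pd {Ω : Set E3} (hΩ : IsOpen Ω) (h0 : (0 : E3) ∈ Ω) {f : E3 → ℝ}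
    (hf : ContDiffOn ℝ (⊤ : ℕ∞) f Ω) (h : IsFlat f) (i : Fin 3) (n : ℕ) :
    IsFlat ((_root_.pd i)^[n] f) := by
  induction n with
  | zero => exact h
  | succ n ih =>
    rw [Function.iterate_succ_apply']
    exact ih.pd hΩ h0 (hf.iterate_pd hΩ i n) i

theorem IsFlat.mpd_eq_zero {Ω : Set E3} (hΩ : IsOpen Ω) (h0 : (0 : E3) ∈ Ω) {f : E3 → ℝ}
    (hf : ContDiffOn ℝ (⊤ : ℕ∞) f Ω) (h : IsFlat f) (β : Fin 3 → ℕ) : mpd β f 0 = 0 := by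
  have hf2 := hf.iterate_pd hΩ 2 (β 2)
  have hf1 := hf2.iterate_pd hΩ 1 (β 1)
  exact (((h.iterate_pd hΩ h0 hf 2 _).iterate_pd hΩ h0 hf2 1 _).iterate_pd hΩ h0 hf1 0 _).apply_zero

theorem IsFlat.exists_L2_bound {f : E3 → ℝ} (h : IsFlat f) (N : ℝ) :
    ∃ δ > (0 : ℝ), ∃ M : ℝ, ∀ r : ℝ, 0 < r → r ≤ δ →
      r ^ (-N) * Real.sqrt (∫ x in {y : E3 | ‖y‖ ≤ r}, (f x) ^ 2) ≤ M := by
  obtain ⟨n, hn⟩ := exists_nat_ge N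
  obtain ⟨C, hC, δ, hδ, h⟩ := h n
  refine ⟨min 1 δ, by positivity, C * √(volume.real (Metric.closedBall (0 : E3) 1)),
    fun r hr hrδ => ?_⟩
  have hr1 : r ≤ 1 := hrδ.trans (min_le_left _ _)
  have hset : {y : E3 | ‖y‖ ≤ r} = Metric.closedBall 0 r := by ext; simp
  have hint : ∫ x in {y : E3 | ‖y‖ ≤ r}, (f x) ^ 2 ≤
      (C * r ^ n) ^ 2 * volume.real (Metric.closedBall (0 : E3) 1) := by
    have hfin : volume {y : E3 | ‖y‖ ≤ r} < ⊤ := by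
      rw [hset]; exact measure_closedBall_lt_top
    refine (Real.le_norm_self _).trans ((norm_setIntegral_le_of_norm_le_const
      (C := (C * r ^ n) ^ 2) hfin fun x hx => ?_).trans ?_)
    · rw [norm_pow]
      exact pow_le_pow_left₀ (norm_nonneg _) (h r hr (hrδ.trans (min_le_right _ _)) x hx) 2
    · rw [hset]
      exact mul_le_mul_of_nonneg_left (measureReal_mono (Metric.closedBall_subset_closedBall hr1)
        measure_closedBall_lt_top.ne) (by positivity)
  have hsqrt := Real.sqrt_le_sqrt hint
  rw [Real.sqrt_mul (by positivity), Real.sqrt_sq (by positivity)] at hsqrt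
  have hrr : r ^ (-N) * r ^ n ≤ 1 := by
    rw [← Real.rpow_natCast, ← Real.rpow_add hr]
    exact Real.rpow_le_one hr.le hr1 (by linarith)
  calc r ^ (-N) * √(∫ x in {y : E3 | ‖y‖ ≤ r}, (f x) ^ 2)
      ≤ r ^ (-N) * (C * r ^ n * √(volume.real (Metric.closedBall (0 : E3) 1))) := by gcongr
    _ = (r ^ (-N) * r ^ n) * (C * √(volume.real (Metric.closedBall (0 : E3) 1))) := by ring
    _ ≤ 1 * (C * √(volume.real (Metric.closedBall (0 : E3) 1))) := by gcongr
    _ = _ := one_mul _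

theorem volume_real_ball_E3 (x : E3) {r : ℝ} (hr : 0 ≤ r) :
    volume.real (Metric.ball x r) = r ^ 3 * volume.real (Metric.ball (0 : E3) 1) := by
  rw [measureReal_def, Measure.addHaar_ball _ _ hr, ENNReal.toReal_mul,
    ENNReal.toReal_ofReal (by positivity), measureReal_def]
  simp

/-- A Lipschitz function that is large at a point is large in `L²` nearby, so `L²` decay of
every order forces pointwise decay of every order. -/
theorem isFlat_of_L2_bound {Ω : Set E3} (hΩ : IsOpen Ω) (h0 : (0 : E3) ∈ Ω) {f : E3 → ℝ}
    (hf : ContDiffOn ℝ (⊤ : ℕ∞) f Ω)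
    (h : ∀ N : ℝ, 0 < N → ∃ δ > (0 : ℝ), ∃ M : ℝ, ∀ r : ℝ, 0 < r → r ≤ δ →
      r ^ (-N) * Real.sqrt (∫ x in {y : E3 | ‖y‖ ≤ r}, (f x) ^ 2) ≤ M) : IsFlat f := by
  intro m
  set n := m + 1 with hn
  obtain ⟨ρ, hρ, hρΩ⟩ := Metric.isOpen_iff.1 hΩ 0 h0
  have hcd : ContDiffAt ℝ 1 f 0 := (hf.contDiffAt (hΩ.mem_nhds h0)).of_le (by norm_cast)
  obtain ⟨K, t, ht, hK⟩ := hcd.exists_lipschitzOnWith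
  obtain ⟨τ, hτ, hτt⟩ := Metric.mem_nhds_iff.1 ht
  obtain ⟨δ, hδ, M, hM⟩ := h ((3 * n : ℕ) : ℝ) (by positivity)
  set L : ℝ := K + 1 with hL
  have hL1 : 1 ≤ L := by rw [hL]; linarith [K.2]
  set v := volume.real (Metric.ball (0 : E3) 1) with hv
  have hv0 : 0 < v := ENNReal.toReal_pos (Metric.measure_ball_pos _ _ one_pos).ne'
    measure_ball_lt_top.ne
  set A : ℝ := M ^ 2 * 2 ^ (6 * n) + 1 with hA
  have hA0 : 0 < A := by positivity
  set c : ℝ := v / (32 * L ^ 3) with hc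
  have hc0 : 0 < c := by positivity
  refine ⟨1, zero_le_one, min (min 1 (c / A)) (min (δ / 2) (min (ρ / 3) (τ / 3))), by positivity,
    fun r hr hrδ x hx => ?_⟩
  simp only [le_min_iff] at hrδ
  obtain ⟨⟨hr1, hrc⟩, hrδ, hrρ, hrτ⟩ := hrδ
  have hrn : r ^ n ≤ r := by
    simpa using pow_le_pow_of_le_one hr.le hr1 (Nat.succ_le_succ (Nat.zero_le m))
  suffices |f x| ≤ r ^ n by
    rw [one_mul]
    exact this.trans (pow_le_pow_of_le_one hr.le hr1 (Nat.le_succ m))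
  by_contra! hlt
  set s := r ^ n / (2 * L) with hs
  have hs0 : 0 < s := by positivity
  have hsr : s ≤ r := (div_le_self (by positivity) (by linarith)).trans hrn
  have hball : ∀ y ∈ Metric.ball x s, ‖y‖ ≤ 2 * r := fun y hy => by
    have h1 : ‖y - x‖ < s := by simpa [dist_eq_norm] using hy
    have h2 := norm_add_le (y - x) x
    rw [sub_add_cancel] at h2
    linarith
  have hmemt : ∀ y ∈ Metric.ball x s, y ∈ t := fun y hy =>
    hτt (by rw [mem_ball_zero_iff]; linarith [hball y hy])
  have hxs : x ∈ Metric.ball x s := Metric.mem_ball_self hs0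
  have hlow : ∀ y ∈ Metric.ball x s, (r ^ n / 2) ^ 2 ≤ f y ^ 2 := fun y hy => by
    have h1 := hK.dist_le_mul x (hmemt x hxs) y (hmemt y hy)
    have h2 : dist x y ≤ s := by rw [dist_comm]; exact (Metric.mem_ball.1 hy).le
    have h3 : (K : ℝ) * dist x y ≤ L * s :=
      mul_le_mul (by rw [hL]; linarith) h2 dist_nonneg (by linarith)
    have h4 : L * s = r ^ n / 2 := by rw [hs]; field_simp
    rw [Real.dist_eq] at h1
    have h5 := abs_sub_abs_le_abs_sub (f x) (f y)
    rw [← sq_abs (f y)]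
    exact pow_le_pow_left₀ (by positivity) (by linarith) 2
  have hset : {y : E3 | ‖y‖ ≤ 2 * r} = Metric.closedBall 0 (2 * r) := by ext; simp
  have hint : IntegrableOn (fun y => f y ^ 2) {y : E3 | ‖y‖ ≤ 2 * r} := by
    rw [hset]
    refine ContinuousOn.integrableOn_compact (isCompact_closedBall _ _) ?_
    exact (hf.continuousOn.mono ((Metric.closedBall_subset_ball (by linarith)).trans hρΩ)).pow 2
  have hge : (r ^ n / 2) ^ 2 * (s ^ 3 * v) ≤ ∫ y in {y : E3 | ‖y‖ ≤ 2 * r}, f y ^ 2 := by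
    rw [hv, ← volume_real_ball_E3 x hs0.le]
    refine (setIntegral_ge_of_const_le_real measurableSet_ball measure_ball_lt_top.ne hlow
      (hint.mono_set hball)).trans ?_
    exact setIntegral_mono_set hint (Filter.Eventually.of_forall fun y => sq_nonneg (f y))
      (Filter.Eventually.of_forall hball)
  have hle := hM (2 * r) (by linarith) (by linarith)
  rw [Real.rpow_neg (by positivity), Real.rpow_natCast, inv_mul_le_iff₀ (by positivity)] at hle
  have hle2 : ∫ y in {y : E3 | ‖y‖ ≤ 2 * r}, f y ^ 2 ≤ ((2 * r) ^ (3 * n) * M) ^ 2 := by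
    rw [← Real.sq_sqrt (integral_nonneg fun y => sq_nonneg (f y))]
    exact pow_le_pow_left₀ (Real.sqrt_nonneg _) hle 2
  have e1 : (r ^ n / 2) ^ 2 * (s ^ 3 * v) = (r ^ n) ^ 5 * c := by
    rw [hs, hc]; field_simp; norm_num
  have e2 : ((2 * r) ^ (3 * n) * M) ^ 2 = (r ^ n) ^ 5 * ((A - 1) * r ^ n) := by
    rw [hA]; ring
  have h6 : c ≤ (A - 1) * r ^ n := by
    have := hge.trans hle2
    rw [e1, e2] at this
    exact le_of_mul_le_mul_left this (by positivity)
  have h7 : A * r ≤ c := by rwa [le_div_iff₀ hA0, mul_comm] at hrc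
  have h8 : A * r ^ n ≤ A * r := by gcongr
  have h9 : 0 < r ^ n := by positivity
  linarith

/-- **Characterization of vanishing to infinite order** (Definition 1.1).  For a
smooth function `f` on an open neighborhood `Ω` of `0` in `ℝ³`, all partial
derivatives of `f` vanish at `0` if and only if, for every `N > 0`, the quantity
`sup_{0 < r ≤ δ} r^{-N} ‖f‖_{L²(B(0,r))}` is finite for some `δ > 0`. -/
theorem flatness_iff_L2_vanishing
    (Ω : Set E3) (hΩopen : IsOpen Ω) (h0Ω : (0 : E3) ∈ Ω)
    (f : E3 → ℝ) (hf : ContDiffOn ℝ (⊤ : ℕ∞) f Ω) :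
    (∀ β : Fin 3 → ℕ, mpd β f 0 = 0) ↔
      (∀ N : ℝ, 0 < N → ∃ δ > (0 : ℝ), ∃ M : ℝ, ∀ r : ℝ, 0 < r → r ≤ δ →
        r ^ (-N) * Real.sqrt (∫ x in {y : E3 | ‖y‖ ≤ r}, (f x) ^ 2) ≤ M) := by
  exact ⟨fun h N _ => (isFlat_of_mpd_eq_zero hΩopen h0Ω hf h).exists_L2_bound N,
    fun h => (isFlat_of_L2_bound hΩopen h0Ω hf h).mpd_eq_zero hΩopen h0Ω hf⟩
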